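/- The substitution φ induces an injective endomorphism of G: there exists an injective group homomorphism G → G sending a ↦ b, b ↦ c, c ↦ aba. -/

import Mathlib

/-- The tree automorphism `a` as a function: flips the first letter. -/
def aFun : List Bool → List Bool
  | [] => []
  | x :: w => (!x) :: w

mutual
  /-- The tree automorphism `b` as a function. -/
  def bFun : List Bool → List Bool
    | [] => []
    | false :: w => false :: aFun w
    | true :: w => true :: cFun w
  /-- The tree automorphism `c` as a function. -/
  def cFun : List Bool → List Bool
    | [] => []
    | false :: w => false :: bFun w
    | true :: w => true :: w
end

theorem aFun_involutive : Function.Involutive aFun := by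
  intro w
  cases w with
  | nil => rfl
  | cons x t => cases x <;> rfl

theorem bcFun_involutive : ∀ w, bFun (bFun w) = w ∧ cFun (cFun w) = w := by
  intro w
  induction w with
  | nil => exact ⟨rfl, rfl⟩
  | cons x t ih =>
    cases x
    · exact ⟨by simp [bFun, aFun_involutive t], by simp [cFun, ih.1]⟩
    · exact ⟨by simp [bFun, ih.2], by simp [cFun]⟩

/-- The tree automorphism `a` of the binary rooted tree `{0,1}*`. -/
def treeA : Equiv.Perm (List Bool) := Function.Involutive.toPerm aFun aFun_involutive

/-- The tree automorphism `b` of the binary rooted tree `{0,1}*`. -/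
def treeB : Equiv.Perm (List Bool) :=
  Function.Involutive.toPerm bFun (fun w => (bcFun_involutive w).1)

/-- The tree automorphism `c` of the binary rooted tree `{0,1}*`. -/
def treeC : Equiv.Perm (List Bool) :=
  Function.Involutive.toPerm cFun (fun w => (bcFun_involutive w).2)

/-- The group `G = IMG(z²+i)`, the subgroup of `Perm({0,1}*)` generated by `a`, `b`, `c`. -/
def IMG : Subgroup (Equiv.Perm (List Bool)) := Subgroup.closure {treeA, treeB, treeC}

theorem treeA_mem_IMG : treeA ∈ IMG := Subgroup.subset_closure (by simp)
theorem treeB_mem_IMG : treeB ∈ IMG := Subgroup.subset_closure (by simp)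
theorem treeC_mem_IMG : treeC ∈ IMG := Subgroup.subset_closure (by simp)

/-- `a` as an element of the group `G`. -/
def gA : IMG := ⟨treeA, treeA_mem_IMG⟩
/-- `b` as an element of the group `G`. -/
def gB : IMG := ⟨treeB, treeB_mem_IMG⟩
/-- `c` as an element of the group `G`. -/
def gC : IMG := ⟨treeC, treeC_mem_IMG⟩

theorem treeA_apply (w : List Bool) : treeA w = aFun w := rfl

theorem treeA_symm_apply (w : List Bool) : treeA.symm w = aFun w := rfl

theorem treeB_symm_apply (w : List Bool) : treeB.symm w = bFun w := rfl

theorem treeC_apply (w : List Bool) : treeC w = cFun w := rfl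

theorem treeC_symm_apply (w : List Bool) : treeC.symm w = cFun w := rfl

/-- A `Bool`-labelling of words is alternating if siblings on the third level carry opposite
labels. -/
def IsAlternating (o : List Bool → Bool) : Prop :=
  ∀ x y, o [x, y, true] = !o [x, y, false]

theorem isAlternating_iff (o : List Bool → Bool) : IsAlternating o ↔
    (o [false, false, true] = !o [false, false, false]) ∧
    (o [false, true, true] = !o [false, true, false]) ∧
    (o [true, false, true] = !o [true, false, false]) ∧
    (o [true, true, true] = !o [true, true, false]) := by
  simp [IsAlternating, and_assoc]

/-- The parity of the labels below the vertex `x`, read off at the children `0` of the second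
level. -/
def branchParity (o : List Bool → Bool) (x : Bool) : Bool :=
  xor (o [x, false, false]) (o [x, true, false])

/-- The word attached to a labelling `o` and a word `u`: the first letter compares the two branch
parities, and `b` is applied to `u` according to the parity of branch `1`. -/
def parityWord (o : List Bool → Bool) (u : List Bool) : List Bool :=
  (!xor (branchParity o false) (branchParity o true)) ::
    cond (branchParity o true) (bFun u) u

/-- `t` acts on parity words in the way `g` acts on alternating labellings. For `g` in `G` this
says that `t` is the image of `g` under `a ↦ c`, `b ↦ 1`, `c ↦ a`. -/
structure Shadows (t g : Equiv.Perm (List Bool)) : Prop where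
  alternating_iff : ∀ o, IsAlternating (o ∘ g.symm) ↔ IsAlternating o
  apply_nil : t [] = []
  apply_parityWord : ∀ o, IsAlternating o →
    ∀ u, t (parityWord o u) = parityWord (o ∘ g.symm) u

namespace Shadows

theorem one : Shadows 1 1 :=
  ⟨fun _ => Iff.rfl, rfl, fun _ _ _ => rfl⟩

theorem mul {t g t' g' : Equiv.Perm (List Bool)} (h : Shadows t g) (h' : Shadows t' g') :
    Shadows (t * t') (g * g') where
  alternating_iff o := (h.alternating_iff (o ∘ g'.symm)).trans (h'.alternating_iff o)
  apply_nil := by rw [Equiv.Perm.mul_apply, h'.apply_nil, h.apply_nil]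
  apply_parityWord o ho u := by
    rw [Equiv.Perm.mul_apply, h'.apply_parityWord o ho,
      h.apply_parityWord _ ((h'.alternating_iff o).2 ho)]
    rfl

theorem inv {t g : Equiv.Perm (List Bool)} (h : Shadows t g) : Shadows t⁻¹ g⁻¹ := by
  have cancel : ∀ o : List Bool → Bool, (o ∘ (g⁻¹).symm) ∘ g.symm = o := fun o =>
    funext fun w => congrArg o (g.apply_symm_apply w)
  have alternating : ∀ o, IsAlternating (o ∘ (g⁻¹).symm) ↔ IsAlternating o := fun o => by
    rw [← h.alternating_iff, cancel]
  refine ⟨alternating, ?_, fun o ho u => ?_⟩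
  · rw [Equiv.Perm.inv_eq_iff_eq, h.apply_nil]
  · rw [Equiv.Perm.inv_eq_iff_eq, h.apply_parityWord _ ((alternating o).2 ho), cancel]

theorem eq_one {t : Equiv.Perm (List Bool)} (h : Shadows t 1) : t = 1 := by
  ext1 w
  rcases w with _ | ⟨x, u⟩
  · exact h.apply_nil
  · let o : List Bool → Bool
      | [false, true, z] => xor z (!x)
      | [_, _, z] => z
      | _ => false
    have ho : IsAlternating o := by
      intro y z
      cases y <;> cases z <;> simp [o]
    have hw : parityWord o u = x :: u := by simp [parityWord, branchParity, o]
    have key := h.apply_parityWord o ho u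
    rw [hw] at key
    exact key.trans hw

theorem treeC_treeA : Shadows treeC treeA where
  alternating_iff o := by
    simp [IsAlternating, treeA_symm_apply, aFun, and_comm]
  apply_nil := rfl
  apply_parityWord o ho u := by
    have hb := (bcFun_involutive u).1
    simp only [parityWord, branchParity, treeA_symm_apply, treeC_apply, Function.comp_apply,
      aFun, Bool.not_false, Bool.not_true]
    generalize xor (o [false, false, false]) (o [false, true, false]) = p
    generalize xor (o [true, false, false]) (o [true, true, false]) = q
    cases p <;> cases q <;> simp [cFun, hb]

theorem one_treeB : Shadows 1 treeB where
  alternating_iff o := by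
    simp only [isAlternating_iff, Function.comp_apply, treeB_symm_apply, aFun, Bool.not_false,
      Bool.not_true, bFun, cFun]
    tauto
  apply_nil := rfl
  apply_parityWord o ho u := by
    simp [parityWord, branchParity, treeB_symm_apply, aFun, bFun, cFun, Bool.xor_comm]

theorem treeA_treeC : Shadows treeA treeC where
  alternating_iff o := by
    simp only [isAlternating_iff, Function.comp_apply, treeC_symm_apply, aFun, Bool.not_false,
      Bool.not_true, bFun, cFun, Bool.eq_not]
    rw [ne_comm]
  apply_nil := rfl
  apply_parityWord o ho u := by
    simp [parityWord, branchParity, treeA_apply, treeC_symm_apply, aFun, bFun, cFun, ho false false]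

end Shadows

/-- `h` fixes the first level of the tree and has sections `g` at `0` and `t` at `1`. -/
structure HasSections (h g t : Equiv.Perm (List Bool)) : Prop where
  apply_nil : h [] = []
  apply_false : ∀ w, h (false :: w) = false :: g w
  apply_true : ∀ w, h (true :: w) = true :: t w

namespace HasSections

theorem one : HasSections 1 1 1 :=
  ⟨rfl, fun _ => rfl, fun _ => rfl⟩

theorem mul {h g t h' g' t' : Equiv.Perm (List Bool)} (hs : HasSections h g t)
    (hs' : HasSections h' g' t') : HasSections (h * h') (g * g') (t * t') where
  apply_nil := by rw [Equiv.Perm.mul_apply, hs'.apply_nil, hs.apply_nil]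
  apply_false w := by simp [hs.apply_false, hs'.apply_false]
  apply_true w := by simp [hs.apply_true, hs'.apply_true]

theorem inv {h g t : Equiv.Perm (List Bool)} (hs : HasSections h g t) :
    HasSections h⁻¹ g⁻¹ t⁻¹ where
  apply_nil := by rw [Equiv.Perm.inv_eq_iff_eq, hs.apply_nil]
  apply_false w := by
    rw [Equiv.Perm.inv_eq_iff_eq, hs.apply_false]
    exact congrArg _ (g.apply_symm_apply w).symm
  apply_true w := by
    rw [Equiv.Perm.inv_eq_iff_eq, hs.apply_true]
    exact congrArg _ (t.apply_symm_apply w).symm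

theorem eq_one {h : Equiv.Perm (List Bool)} (hs : HasSections h 1 1) : h = 1 := by
  ext1 w
  rcases w with _ | ⟨_ | _, w⟩
  · exact hs.apply_nil
  · exact hs.apply_false w
  · exact hs.apply_true w

theorem eq_one_left {g t : Equiv.Perm (List Bool)} (hs : HasSections 1 g t) : g = 1 := by
  ext1 w
  exact (List.cons.inj (hs.apply_false w)).2.symm

end HasSections

/-- The graph of the substitution `a ↦ b`, `b ↦ c`, `c ↦ aba`, as a subgroup of `G × G`. -/
def phiGraph : Subgroup (IMG × IMG) :=
  Subgroup.closure {(gA, gB), (gB, gC), (gC, gA * gB * gA)}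

theorem gA_gB_mem_phiGraph : (gA, gB) ∈ phiGraph := Subgroup.subset_closure (by simp)

theorem gB_gC_mem_phiGraph : (gB, gC) ∈ phiGraph := Subgroup.subset_closure (by simp)

theorem gC_conj_mem_phiGraph : (gC, gA * gB * gA) ∈ phiGraph :=
  Subgroup.subset_closure (by simp)

theorem exists_hasSections_of_mem_phiGraph {p : IMG × IMG} (hp : p ∈ phiGraph) :
    ∃ t : Equiv.Perm (List Bool),
      HasSections (p.2 : Equiv.Perm (List Bool)) p.1 t ∧ Shadows t p.1 := by
  induction hp using Subgroup.closure_induction with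
  | mem p hp =>
    rcases hp with rfl | rfl | rfl
    · exact ⟨treeC, ⟨rfl, fun _ => rfl, fun _ => rfl⟩, .treeC_treeA⟩
    · exact ⟨1, ⟨rfl, fun _ => rfl, fun _ => rfl⟩, .one_treeB⟩
    · exact ⟨treeA, ⟨rfl, fun _ => rfl, fun _ => rfl⟩, .treeA_treeC⟩
  | one => exact ⟨1, .one, .one⟩
  | mul p q _ _ hp hq =>
    obtain ⟨t, hs, ht⟩ := hp
    obtain ⟨t', hs', ht'⟩ := hq
    exact ⟨t * t', hs.mul hs', ht.mul ht'⟩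
  | inv p _ hp =>
    obtain ⟨t, hs, ht⟩ := hp
    exact ⟨t⁻¹, hs.inv, ht.inv⟩

theorem phiGraph_fst_eq_one_iff {p : IMG × IMG} (hp : p ∈ phiGraph) : p.1 = 1 ↔ p.2 = 1 := by
  obtain ⟨t, hs, ht⟩ := exists_hasSections_of_mem_phiGraph hp
  constructor <;> intro h
  · rw [h] at hs ht
    obtain rfl := Shadows.eq_one ht
    exact Subtype.ext hs.eq_one
  · rw [h] at hs
    exact Subtype.ext hs.eq_one_left

theorem exists_mem_phiGraph (g : IMG) : ∃ h, (g, h) ∈ phiGraph := by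
  obtain ⟨g, hg⟩ := g
  induction hg using Subgroup.closure_induction with
  | mem g hg =>
    rcases hg with rfl | rfl | rfl
    · exact ⟨_, gA_gB_mem_phiGraph⟩
    · exact ⟨_, gB_gC_mem_phiGraph⟩
    · exact ⟨_, gC_conj_mem_phiGraph⟩
  | one => exact ⟨1, phiGraph.one_mem⟩
  | mul g g' _ _ ih ih' =>
    obtain ⟨h, hh⟩ := ih
    obtain ⟨h', hh'⟩ := ih'
    exact ⟨h * h', phiGraph.mul_mem hh hh'⟩
  | inv g _ ih =>
    obtain ⟨h, hh⟩ := ih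
    exact ⟨h⁻¹, phiGraph.inv_mem hh⟩

/-- the substitution `φ` induces an injective endomorphism of `G` with
`a ↦ b`, `b ↦ c`, `c ↦ aba`. -/
theorem phi_induces_injective_endomorphism :
    ∃ ψ : IMG →* IMG, Function.Injective ψ ∧
      ψ gA = gB ∧ ψ gB = gC ∧ ψ gC = gA * gB * gA := by
  let fst : phiGraph →* IMG := (MonoidHom.fst IMG IMG).comp phiGraph.subtype
  let snd : phiGraph →* IMG := (MonoidHom.snd IMG IMG).comp phiGraph.subtype
  have fst_bijective : Function.Bijective fst := by
    refine ⟨(injective_iff_map_eq_one fst).2 fun p hp => ?_, fun g => ?_⟩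
    · exact Subtype.ext (Prod.ext hp ((phiGraph_fst_eq_one_iff p.2).1 hp))
    · obtain ⟨h, hh⟩ := exists_mem_phiGraph g
      exact ⟨⟨(g, h), hh⟩, rfl⟩
  have snd_injective : Function.Injective snd :=
    (injective_iff_map_eq_one snd).2 fun p hp =>
      Subtype.ext (Prod.ext ((phiGraph_fst_eq_one_iff p.2).2 hp) hp)
  let e : phiGraph ≃* IMG := MulEquiv.ofBijective fst fst_bijective
  have apply_eq : ∀ {g h : IMG}, (g, h) ∈ phiGraph → snd (e.symm g) = h := fun {g h} hh => by
    have : e.symm g = ⟨(g, h), hh⟩ := e.symm_apply_eq.2 rfl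
    rw [this]
    rfl
  exact ⟨snd.comp e.symm.toMonoidHom, snd_injective.comp e.symm.injective,
    apply_eq gA_gB_mem_phiGraph, apply_eq gB_gC_mem_phiGraph, apply_eq gC_conj_mem_phiGraph⟩
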